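/- arXiv:0712.0220 — 3 statements merged into one kernel-verified Lean document; each statement's English description precedes it below -/
import Mathlib

section
/- There exist constants c₁, c₂ > 0 and t₀ such that for every t ≥ t₀ with p = 2^t − 1 prime, the block walk B on Z_p with parameter x = p − 1 has mixing time τ(1/4) satisfying c₁·(log p)·(log log p) ≤ τ(1/4) ≤ c₂·(log p)·(log log p), where τ(ε) = min{T : ∀u,v ∈ Z_p, (1−ε)/p ≤ B^T(u,v) ≤ (1+ε)/p}. -/
open Finset

/-- The block walk associated with the Pollard Rho walk on `Z_N`:
`B(u,v) = ∑_{k=0}^∞ (1/3)(1/3)^k ∑_{a=0}^k C(k,a)·1[2(u + a + (k−a)x) = v]`. -/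
noncomputable def blockMatrix (N : ℕ) (x : ZMod N) : Matrix (ZMod N) (ZMod N) ℝ :=
  fun u v => ∑' k : ℕ, (1 / 3 : ℝ) * (1 / 3) ^ k *
    ∑ a ∈ Finset.range (k + 1),
      (k.choose a : ℝ) *
        (if 2 * (u + (a : ZMod N) + ((k - a : ℕ) : ZMod N) * x) = v then 1 else 0)

/-- The mixing time `τ(ε) = min{T : ∀u,v, (1−ε)/N ≤ B^T(u,v) ≤ (1+ε)/N}` of the block walk. -/
noncomputable def blockMixTime (N : ℕ) [NeZero N] (x : ZMod N) (ε : ℝ) : ℕ :=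
  sInf {T : ℕ | ∀ u v : ZMod N,
    (1 - ε) / N ≤ (blockMatrix N x ^ T) u v ∧ (blockMatrix N x ^ T) u v ≤ (1 + ε) / N}


/-- The Fourier coefficient of a block increment with steps `±1`, as a function of the frequency. -/
noncomputable def incrementFourier {N : ℕ} (y : ZMod N) : ℝ :=
  (3 - 2 * Real.cos (2 * Real.pi * y.val / N))⁻¹

/-- The Fourier coefficient at frequency `y` of `∑ j ∈ {1, …, T}, 2 ^ j * b_j`, with independent
block increments `b_j`. -/
noncomputable def walkFourier {N : ℕ} (T : ℕ) (y : ZMod N) : ℝ :=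
  ∏ j ∈ range T, incrementFourier (2 ^ (j + 1) * y)

section Fourier

variable {N : ℕ}

lemma incrementFourier_pos (y : ZMod N) : 0 < incrementFourier y := by
  have := Real.cos_le_one (2 * Real.pi * y.val / N)
  exact inv_pos.2 (by linarith)

lemma incrementFourier_le_one (y : ZMod N) : incrementFourier y ≤ 1 := by
  have := Real.cos_le_one (2 * Real.pi * y.val / N)
  exact inv_le_one_of_one_le₀ (by linarith)

lemma walkFourier_nonneg (T : ℕ) (y : ZMod N) : 0 ≤ walkFourier T y :=
  prod_nonneg fun _ _ => (incrementFourier_pos _).le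

@[simp] lemma walkFourier_apply_zero (T : ℕ) : walkFourier T (0 : ZMod N) = 1 := by
  simp only [walkFourier, incrementFourier, mul_zero, ZMod.val_zero]
  norm_num

lemma walkFourier_anti {S T : ℕ} (h : S ≤ T) (y : ZMod N) : walkFourier T y ≤ walkFourier S y :=
  prod_le_prod_of_subset_of_le_one (range_mono h)
    (fun _ _ => (incrementFourier_pos _).le) (fun _ _ _ => incrementFourier_le_one _)

lemma hasSum_blockMatrix_apply (x u v : ZMod N) :
    HasSum (fun k : ℕ => (1 / 3 : ℝ) * (1 / 3) ^ k * ∑ a ∈ range (k + 1), (k.choose a : ℝ) *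
      (if 2 * (u + (a : ZMod N) + ((k - a : ℕ) : ZMod N) * x) = v then 1 else 0))
      (blockMatrix N x u v) := by
  refine Summable.hasSum (Summable.of_nonneg_of_le (fun k => by positivity) (fun k => ?_)
    ((summable_geometric_of_lt_one (by norm_num) (by norm_num : (2 / 3 : ℝ) < 1)).mul_left (1 / 3)))
  have h : ∑ a ∈ range (k + 1), (k.choose a : ℝ) *
      (if 2 * (u + (a : ZMod N) + ((k - a : ℕ) : ZMod N) * x) = v then 1 else 0) ≤ 2 ^ k := by
    calc _ ≤ ∑ a ∈ range (k + 1), (k.choose a : ℝ) := by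
          refine sum_le_sum fun a _ => mul_le_of_le_one_right (by positivity) ?_
          split_ifs <;> norm_num
      _ = 2 ^ k := by exact_mod_cast Nat.sum_range_choose k
  calc _ ≤ (1 / 3 : ℝ) * (1 / 3) ^ k * 2 ^ k := by gcongr
    _ = 1 / 3 * (2 / 3) ^ k := by rw [mul_assoc, ← mul_pow]; norm_num

variable [NeZero N]

lemma stdAddChar_add_stdAddChar_neg (y : ZMod N) :
    ZMod.stdAddChar y + ZMod.stdAddChar (-y) =
      ((2 * Real.cos (2 * Real.pi * y.val / N) : ℝ) : ℂ) := by
  have h : ZMod.stdAddChar (-y) = (ZMod.stdAddChar y)⁻¹ := AddChar.map_neg_eq_inv _ _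
  rw [h, ZMod.stdAddChar_apply, ZMod.toCircle_apply, ← Complex.exp_neg]
  push_cast
  rw [Complex.two_cos]
  congr 2 <;> ring

lemma sum_blockMatrix_mul_stdAddChar (u y : ZMod N) :
    ∑ v, (blockMatrix N (-1) u v : ℂ) * ZMod.stdAddChar (y * v) =
      incrementFourier (2 * y) * ZMod.stdAddChar (y * (2 * u)) := by
  have h₁ := hasSum_sum (s := (univ : Finset (ZMod N))) fun v _ =>
    (Complex.hasSum_ofReal.2 (hasSum_blockMatrix_apply (-1) u v)).mul_right
      (ZMod.stdAddChar (y * v))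
  set z : ℂ := ((2 * Real.cos (2 * Real.pi * (2 * y).val / N) : ℝ) : ℂ) with hz
  have hcos := Real.abs_cos_le_one (2 * Real.pi * (2 * y).val / N)
  have hz3 : ‖z / 3‖ < 1 := by
    rw [norm_div, hz, Complex.norm_real, Real.norm_eq_abs, abs_mul, abs_two]
    rw [show ‖(3 : ℂ)‖ = 3 by norm_num, div_lt_one (by norm_num)]
    linarith
  have h₂ := ((hasSum_geometric_of_norm_lt_one hz3).mul_left (1 / 3)).mul_right
    (ZMod.stdAddChar (y * (2 * u)))
  have hval : (1 / 3 * (1 - z / 3)⁻¹ : ℂ) = incrementFourier (2 * y) := by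
    have : (3 - z : ℂ) ≠ 0 := by
      rw [hz, sub_ne_zero]
      exact_mod_cast (by linarith [(abs_le.1 hcos).2] : _ < (3 : ℝ)).ne'
    have h3 : (incrementFourier (2 * y) : ℂ) = (3 - z)⁻¹ := by
      simp [incrementFourier, hz]
    rw [h3]
    have : (1 - z / 3 : ℂ) = (3 - z) / 3 := by ring
    rw [this]
    field_simp
  rw [hval] at h₂
  refine h₁.unique (h₂.congr_fun ?_)
  intro k
  have hψ : ∀ a ∈ range (k + 1), ∑ v : ZMod N,
      ((if 2 * (u + (a : ZMod N) + ((k - a : ℕ) : ZMod N) * -1) = v then 1 else 0 : ℝ) : ℂ) *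
        ZMod.stdAddChar (y * v) =
      ZMod.stdAddChar (2 * y) ^ a * ZMod.stdAddChar (-(2 * y)) ^ (k - a) *
        ZMod.stdAddChar (y * (2 * u)) := fun a _ => by
    simp only [apply_ite ((↑) : ℝ → ℂ), Complex.ofReal_one, Complex.ofReal_zero, ite_mul, one_mul,
      zero_mul, sum_ite_eq, mem_univ, if_true]
    rw [← AddChar.map_nsmul_eq_pow, ← AddChar.map_nsmul_eq_pow, ← AddChar.map_add_eq_mul,
      ← AddChar.map_add_eq_mul]
    congr 1
    simp only [nsmul_eq_mul]
    ring
  have hzk : (z / 3) ^ k = (1 / 3) ^ k * ∑ a ∈ range (k + 1),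
      ZMod.stdAddChar (2 * y) ^ a * ZMod.stdAddChar (-(2 * y)) ^ (k - a) * (k.choose a : ℂ) := by
    rw [hz, ← stdAddChar_add_stdAddChar_neg, ← add_pow, ← mul_pow]
    ring
  rw [hzk]
  push_cast
  simp_rw [mul_assoc, ← mul_sum, sum_mul]
  rw [sum_comm]
  congr 2
  refine sum_congr rfl fun a ha => ?_
  simp_rw [mul_assoc, ← mul_sum]
  rw [hψ a ha]
  ring

lemma sum_blockMatrix_pow_mul_stdAddChar (T : ℕ) (u y : ZMod N) :
    ∑ v, ((blockMatrix N (-1) ^ T) u v : ℂ) * ZMod.stdAddChar (y * v) =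
      walkFourier T y * ZMod.stdAddChar (y * (2 ^ T * u)) := by
  induction T generalizing u with
  | zero => simp [walkFourier, Matrix.one_apply, apply_ite ((↑) : ℝ → ℂ)]
  | succ T ih =>
    simp_rw [pow_succ' (blockMatrix N (-1)) T, Matrix.mul_apply]
    push_cast
    simp_rw [sum_mul]
    rw [sum_comm]
    simp_rw [mul_assoc, ← mul_sum, ih]
    have h : ∀ w : ZMod N, (blockMatrix N (-1) u w : ℂ) *
        (walkFourier T y * ZMod.stdAddChar (y * (2 ^ T * w))) =
        walkFourier T y * ((blockMatrix N (-1) u w : ℂ) *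
          ZMod.stdAddChar ((2 ^ T * y) * w)) := fun w => by
      rw [show y * (2 ^ T * w) = (2 ^ T * y) * w by ring]; ring
    simp_rw [h, ← mul_sum, sum_blockMatrix_mul_stdAddChar]
    rw [walkFourier, walkFourier, prod_range_succ,
      show 2 * (2 ^ T * y) = 2 ^ (T + 1) * y by ring,
      show (2 ^ T * y) * (2 * u) = y * (2 ^ (T + 1) * u) by ring]
    push_cast
    ring

lemma blockMatrix_pow_apply (T : ℕ) (u v : ZMod N) :
    (N : ℂ) * ((blockMatrix N (-1) ^ T) u v : ℂ) =
      ∑ y, (walkFourier T y : ℂ) * ZMod.stdAddChar (y * (2 ^ T * u - v)) := by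
  have h : ∀ y : ZMod N, (walkFourier T y : ℂ) * ZMod.stdAddChar (y * (2 ^ T * u - v)) =
      ∑ w, ((blockMatrix N (-1) ^ T) u w : ℂ) * ZMod.stdAddChar (y * (w - v)) := fun y => by
    simp_rw [mul_sub, sub_eq_add_neg, AddChar.map_add_eq_mul, ← mul_assoc _ (ZMod.stdAddChar _),
      ← sum_mul]
    rw [sum_blockMatrix_pow_mul_stdAddChar]
  simp_rw [h]
  rw [sum_comm]
  simp_rw [← mul_sum, AddChar.sum_mulShift _ (ZMod.isPrimitive_stdAddChar N)]
  simp [sub_eq_zero, mul_comm]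

lemma abs_blockMatrix_pow_sub_one_le (T : ℕ) (u v : ZMod N) :
    |N * (blockMatrix N (-1) ^ T) u v - 1| ≤ ∑ y : ZMod N with y ≠ 0, walkFourier T y := by
  have h := blockMatrix_pow_apply T u v
  rw [← sum_filter_add_sum_filter_not univ (fun y : ZMod N => y ≠ 0)] at h
  have h0 : ∑ y : ZMod N with ¬ y ≠ 0,
      (walkFourier T y : ℂ) * ZMod.stdAddChar (y * (2 ^ T * u - v)) = 1 := by
    simp [filter_eq']
  rw [h0, ← sub_eq_iff_eq_add] at h
  calc |N * (blockMatrix N (-1) ^ T) u v - 1|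
      = ‖(N : ℂ) * ((blockMatrix N (-1) ^ T) u v : ℂ) - 1‖ := by
        rw [← Real.norm_eq_abs, ← Complex.norm_real]; push_cast; rfl
    _ ≤ ∑ y : ZMod N with y ≠ 0, ‖(walkFourier T y : ℂ) * ZMod.stdAddChar (y * (2 ^ T * u - v))‖ := by
        rw [h]; exact norm_sum_le _ _
    _ = ∑ y : ZMod N with y ≠ 0, walkFourier T y := by
        refine sum_congr rfl fun y _ => ?_
        rw [norm_mul, AddChar.norm_apply, mul_one, Complex.norm_real,
          Real.norm_of_nonneg (walkFourier_nonneg T y)]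

lemma blockMatrix_pow_apply_zero (T : ℕ) :
    N * (blockMatrix N (-1) ^ T) 0 0 = 1 + ∑ y : ZMod N with y ≠ 0, walkFourier T y := by
  have h := blockMatrix_pow_apply T (0 : ZMod N) 0
  simp only [mul_zero, sub_zero, AddChar.map_zero_eq_one, mul_one] at h
  have h' : N * (blockMatrix N (-1) ^ T) 0 0 = ∑ y : ZMod N, walkFourier T y :=
    Complex.ofReal_injective (by push_cast; exact h)
  rw [h', ← sum_filter_add_sum_filter_not univ (fun y : ZMod N => y ≠ 0), add_comm]
  congr 1
  simp [filter_eq']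

end Fourier

section Mersenne

variable {p t : ℕ}

lemma two_pow_eq_one_of_succ_eq (hp : p + 1 = 2 ^ t) : (2 ^ t : ZMod p) = 1 := by
  have h : ((p + 1 : ℕ) : ZMod p) = ((2 ^ t : ℕ) : ZMod p) := by rw [hp]
  push_cast at h
  simpa using h.symm

lemma walkFourier_period (hp : p + 1 = 2 ^ t) (y : ZMod p) :
    walkFourier t y = ∏ j ∈ range t, incrementFourier (2 ^ j * y) := by
  have h := prod_range_succ (fun j => incrementFourier (2 ^ j * y)) t
  rw [prod_range_succ', two_pow_eq_one_of_succ_eq hp, pow_zero] at h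
  exact mul_right_cancel₀ (incrementFourier_pos _).ne' h

lemma walkFourier_period_mul (hp : p + 1 = 2 ^ t) (m : ℕ) (y : ZMod p) :
    walkFourier (t * m) y = walkFourier t y ^ m := by
  induction m with
  | zero => simp [walkFourier]
  | succ m ih =>
    rw [pow_succ, ← ih, walkFourier, mul_add_one, prod_range_add]
    congr 1
    refine prod_congr rfl fun j _ => ?_
    rw [add_assoc, pow_add, pow_mul, two_pow_eq_one_of_succ_eq hp, one_pow, one_mul]

lemma walkFourier_period_two_pow_mul (hp : p + 1 = 2 ^ t) (k : ℕ) (y : ZMod p) :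
    walkFourier t (2 ^ k * y) = walkFourier t y := by
  induction k with
  | zero => simp
  | succ k ih =>
    rw [← ih, walkFourier_period hp, walkFourier]
    refine prod_congr rfl fun j _ => ?_
    congr 1
    ring

lemma exp_neg_sixty_le_walkFourier_one (ht : 2 ≤ t) (hp : p + 1 = 2 ^ t) :
    Real.exp (-60) ≤ walkFourier t (1 : ZMod p) := by
  have h4 : 2 ^ 2 ≤ 2 ^ t := Nat.pow_le_pow_right two_pos ht
  have hp0 : (0 : ℝ) < p := by exact_mod_cast (by omega : 0 < p)
  have hpt : (2 : ℝ) ^ t ≤ 4 / 3 * p := by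
    have : 3 * 2 ^ t ≤ 4 * p := by omega
    have : (3 : ℝ) * 2 ^ t ≤ 4 * p := by exact_mod_cast this
    linarith
  have hterm : ∀ j ∈ range t, Real.exp (-(4 * Real.pi ^ 2 / p ^ 2 * 4 ^ j)) ≤
      incrementFourier (2 ^ j * (1 : ZMod p)) := by
    intro j hj
    have hlt : 2 ^ j < p := by
      have : 2 ^ (j + 1) ≤ 2 ^ t := Nat.pow_le_pow_right two_pos (mem_range.1 hj)
      have hj1 : 2 ^ (j + 1) = 2 * 2 ^ j := by ring
      omega
    have hval : ((2 ^ j * 1 : ZMod p)).val = 2 ^ j := by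
      have := ZMod.val_natCast_of_lt hlt
      push_cast at this
      rwa [mul_one]
    rw [incrementFourier, hval, Real.exp_neg]
    set x : ℝ := 2 * Real.pi * ((2 ^ j : ℕ) : ℝ) / p with hx
    have hx2 : 4 * Real.pi ^ 2 / p ^ 2 * 4 ^ j = x ^ 2 := by
      rw [hx, div_pow, mul_pow, mul_pow]
      push_cast
      rw [← pow_mul, mul_comm j 2, pow_mul]
      norm_num
      ring
    rw [hx2]
    refine inv_anti₀ (by linarith [Real.cos_le_one x]) ?_
    linarith [Real.one_sub_sq_div_two_le_cos (x := x), Real.add_one_le_exp (x ^ 2)]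
  rw [walkFourier_period hp]
  refine le_trans ?_ (prod_le_prod (fun _ _ => (Real.exp_pos _).le) hterm)
  rw [← Real.exp_sum, Real.exp_le_exp, sum_neg_distrib, ← mul_sum, geom_sum_eq (by norm_num)]
  have hpi : Real.pi ^ 2 ≤ 10 := by nlinarith [Real.pi_lt_d2, Real.pi_pos]
  have h4t : (4 : ℝ) ^ t ≤ 16 / 9 * p ^ 2 := by
    have : (4 : ℝ) ^ t = (2 ^ t) ^ 2 := by rw [← pow_mul, mul_comm t 2, pow_mul]; norm_num
    rw [this]
    calc ((2 : ℝ) ^ t) ^ 2 ≤ (4 / 3 * p) ^ 2 := by gcongr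
      _ = _ := by ring
  have : 4 * Real.pi ^ 2 / p ^ 2 * ((4 ^ t - 1) / (4 - 1)) ≤
      4 * 10 / p ^ 2 * ((16 / 9 * (p : ℝ) ^ 2) / (4 - 1)) := by
    gcongr
    · exact div_nonneg (sub_nonneg.2 (one_le_pow₀ (by norm_num))) (by norm_num)
    linarith
  have h2 : 4 * 10 / p ^ 2 * ((16 / 9 * (p : ℝ) ^ 2) / (4 - 1)) = 640 / 27 := by
    field_simp
    norm_num
  rw [h2] at this
  linarith

lemma mul_exp_le_sum_walkFourier [NeZero p] (ht : 2 ≤ t) (hp : p + 1 = 2 ^ t) {m T : ℕ}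
    (hT : T ≤ t * m) :
    t * Real.exp (-60 * m) ≤ ∑ y : ZMod p with y ≠ 0, walkFourier T y := by
  have hlt : ∀ k ∈ range t, 2 ^ k < p := fun k hk => by
    have : 2 ^ (k + 1) ≤ 2 ^ t := Nat.pow_le_pow_right two_pos (mem_range.1 hk)
    have hk1 : 2 ^ (k + 1) = 2 * 2 ^ k := by ring
    have : 2 ^ 2 ≤ 2 ^ t := Nat.pow_le_pow_right two_pos ht
    omega
  have hval : ∀ k ∈ range t, (2 ^ k : ZMod p).val = 2 ^ k := fun k hk => by
    simpa using ZMod.val_natCast_of_lt (hlt k hk)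
  have hinj : Set.InjOn (fun k => (2 ^ k : ZMod p)) (range t) := fun k hk l hl h => by
    have := congrArg ZMod.val h
    simp only [hval k hk, hval l hl] at this
    exact Nat.pow_right_injective le_rfl this
  calc (t : ℝ) * Real.exp (-60 * m) = ∑ k ∈ range t, Real.exp (-60) ^ m := by
        rw [sum_const, card_range, nsmul_eq_mul, ← Real.exp_nat_mul, mul_comm (m : ℝ)]
    _ ≤ ∑ k ∈ range t, walkFourier T (2 ^ k : ZMod p) := by
        refine sum_le_sum fun k _ => ?_
        refine le_trans ?_ (walkFourier_anti hT _)
        rw [walkFourier_period_mul hp, ← mul_one (2 ^ k : ZMod p),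
          walkFourier_period_two_pow_mul hp]
        gcongr
        exact exp_neg_sixty_le_walkFourier_one ht hp
    _ = ∑ y ∈ (range t).image fun k => (2 ^ k : ZMod p), walkFourier T y :=
        (sum_image hinj).symm
    _ ≤ _ := by
        refine sum_le_sum_of_subset_of_nonneg ?_ fun y _ _ => walkFourier_nonneg T y
        intro y hy
        obtain ⟨k, hk, rfl⟩ := mem_image.1 hy
        refine mem_filter.2 ⟨mem_univ _, fun h0 => ?_⟩
        have := hval k hk
        rw [h0, ZMod.val_zero] at this
        exact (pow_pos two_pos k).ne this

/-- The leading binary digit of `y / p` is `1`. -/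
def LeadingOne (y : ZMod p) : Prop := p < 2 * y.val

instance (y : ZMod p) : Decidable (LeadingOne y) := inferInstanceAs (Decidable (p < 2 * y.val))

/-- The positions among the first `t` binary digits of `y / p` followed by a different digit. -/
def alternations (t : ℕ) (y : ZMod p) : Finset ℕ :=
  {j ∈ range t | ¬ (LeadingOne (2 ^ j * y) ↔ LeadingOne (2 ^ (j + 1) * y))}

lemma leadingOne_iff_of_alternations_eq {y z : ZMod p} (h : LeadingOne y ↔ LeadingOne z)
    (ha : alternations t y = alternations t z) {j : ℕ} (hj : j ≤ t) :
    LeadingOne (2 ^ j * y) ↔ LeadingOne (2 ^ j * z) := by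
  induction j with
  | zero => simpa using h
  | succ j ih =>
    have h1 := ih (by omega)
    have h2 : j ∈ alternations t y ↔ j ∈ alternations t z := by rw [ha]
    simp only [alternations, mem_filter, mem_range, show j < t by omega, true_and] at h2
    tauto

variable [NeZero p]

lemma LeadingOne.val_two_mul {y : ZMod p} (h : LeadingOne y) : (2 * y).val + p = 2 * y.val := by
  have hlt := ZMod.val_lt y
  rw [LeadingOne] at h
  have h2 : ((2 * y.val - p : ℕ) : ZMod p) = 2 * y := by
    rw [Nat.cast_sub h.le]
    simp
  rw [← h2, ZMod.val_natCast_of_lt (by omega)]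
  omega

lemma val_two_mul_of_not_leadingOne (hodd : Odd p) {y : ZMod p} (h : ¬ LeadingOne y) :
    (2 * y).val = 2 * y.val := by
  rw [LeadingOne] at h
  obtain ⟨k, hk⟩ := hodd
  have h2 : ((2 * y.val : ℕ) : ZMod p) = 2 * y := by simp
  rw [← h2, ZMod.val_natCast_of_lt (by omega)]

lemma incrementFourier_le_one_third (hodd : Odd p) {y : ZMod p}
    (h : ¬ (LeadingOne y ↔ LeadingOne (2 * y))) : incrementFourier y ≤ 1 / 3 := by
  have hp0 : (0 : ℝ) < p := by exact_mod_cast NeZero.pos p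
  have hb : p ≤ 4 * y.val ∧ 4 * y.val ≤ 3 * p := by
    have hlt := ZMod.val_lt y
    by_cases hy : LeadingOne y
    · have := hy.val_two_mul
      rw [iff_true_left hy, LeadingOne] at h
      simp only [LeadingOne] at hy
      omega
    · have := val_two_mul_of_not_leadingOne hodd hy
      rw [iff_false_left hy, not_not, LeadingOne] at h
      simp only [LeadingOne] at hy
      omega
  have h1 : (p : ℝ) ≤ 4 * y.val := by exact_mod_cast hb.1
  have h2 : 4 * (y.val : ℝ) ≤ 3 * p := by exact_mod_cast hb.2
  have hcos : Real.cos (2 * Real.pi * y.val / p) ≤ 0 := by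
    apply Real.cos_nonpos_of_pi_div_two_le_of_le
    · rw [le_div_iff₀ hp0]
      nlinarith [Real.pi_pos]
    · rw [div_le_iff₀ hp0]
      nlinarith [Real.pi_pos]
  rw [incrementFourier, ← one_div]
  exact one_div_le_one_div_of_le (by norm_num) (by linarith)

lemma walkFourier_period_le (hodd : Odd p) (hp : p + 1 = 2 ^ t) (y : ZMod p) :
    walkFourier t y ≤ (1 / 3) ^ (alternations t y).card := by
  rw [walkFourier_period hp]
  calc _ ≤ ∏ j ∈ alternations t y, incrementFourier (2 ^ j * y) :=
        prod_le_prod_of_subset_of_le_one (filter_subset _ _)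
          (fun _ _ => (incrementFourier_pos _).le) (fun _ _ _ => incrementFourier_le_one _)
    _ ≤ ∏ j ∈ alternations t y, (1 / 3 : ℝ) := by
        refine prod_le_prod (fun _ _ => (incrementFourier_pos _).le) fun j hj => ?_
        refine incrementFourier_le_one_third hodd ?_
        have := (mem_filter.1 hj).2
        rwa [pow_succ', mul_assoc] at this
    _ = _ := by rw [prod_const]

lemma eq_of_alternations_eq (hodd : Odd p) (hp : p + 1 = 2 ^ t) {y z : ZMod p}
    (h : LeadingOne y ↔ LeadingOne z) (ha : alternations t y = alternations t z) : y = z := by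
  have hdiff : ∀ j ≤ t, ((2 ^ j * y).val : ℤ) - (2 ^ j * z).val = 2 ^ j * (y.val - z.val) := by
    intro j hj
    induction j with
    | zero => simp
    | succ j ih =>
      have hiff := leadingOne_iff_of_alternations_eq h ha (show j ≤ t by omega)
      have ih := ih (by omega)
      rw [pow_succ' (2 : ZMod p), mul_assoc, mul_assoc, pow_succ' (2 : ℤ), mul_assoc, ← ih]
      by_cases hy : LeadingOne (2 ^ j * y)
      · have h1 := hy.val_two_mul
        have h2 := (hiff.1 hy).val_two_mul
        omega
      · have h1 := val_two_mul_of_not_leadingOne hodd hy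
        have h2 := val_two_mul_of_not_leadingOne hodd (fun hz => hy (hiff.2 hz))
        omega
  have ht := hdiff t le_rfl
  rw [two_pow_eq_one_of_succ_eq hp, one_mul, one_mul] at ht
  have hpt : (2 : ℤ) ^ t = p + 1 := by exact_mod_cast hp.symm
  have hp0 : (p : ℤ) ≠ 0 := by exact_mod_cast NeZero.ne p
  have : (p : ℤ) * (y.val - z.val) = 0 := by rw [hpt] at ht; linarith
  have := (mul_eq_zero.1 this).resolve_left hp0
  exact ZMod.val_injective p (by omega)

lemma eq_zero_of_alternations_eq_empty (hodd : Odd p) (hp : p + 1 = 2 ^ t) {y : ZMod p}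
    (ha : alternations t y = ∅) : y = 0 := by
  by_cases hy : LeadingOne y
  · have hcst : ∀ j ≤ t, LeadingOne (2 ^ j * y) ∧
        ((p : ℤ) - (2 ^ j * y).val = 2 ^ j * (p - y.val)) := by
      intro j hj
      induction j with
      | zero => simpa using hy
      | succ j ih =>
        obtain ⟨h1, h2⟩ := ih (by omega)
        have h3 : j ∉ alternations t y := by simp [ha]
        simp only [alternations, mem_filter, mem_range, show j < t by omega, true_and, not_not,
          h1, true_iff] at h3
        refine ⟨h3, ?_⟩
        rw [pow_succ' (2 : ZMod p), mul_assoc, pow_succ' (2 : ℤ), mul_assoc, ← h2]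
        have := h1.val_two_mul
        omega
    have ht := (hcst t le_rfl).2
    have hpt : (2 : ℤ) ^ t = p + 1 := by exact_mod_cast hp.symm
    have hlt := ZMod.val_lt y
    rw [two_pow_eq_one_of_succ_eq hp, one_mul, hpt] at ht
    nlinarith [NeZero.pos p]
  · refine eq_of_alternations_eq hodd hp (by simpa [LeadingOne] using hy) ?_
    rw [ha]
    simp [alternations, LeadingOne]

lemma sum_walkFourier_le (hodd : Odd p) (hp : p + 1 = 2 ^ t) (m : ℕ) :
    ∑ y : ZMod p with y ≠ 0, walkFourier (t * m) y ≤ 2 * (((1 / 3) ^ m + 1) ^ t - 1) := by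
  have hinj : Set.InjOn (fun y : ZMod p => (decide (LeadingOne y), alternations t y))
      ({y : ZMod p | y ≠ 0} : Finset (ZMod p)) := fun y _ z _ h => by
    simp only [Prod.mk.injEq, decide_eq_decide] at h
    exact eq_of_alternations_eq hodd hp h.1 h.2
  calc ∑ y : ZMod p with y ≠ 0, walkFourier (t * m) y
      ≤ ∑ y : ZMod p with y ≠ 0, (((1 / 3 : ℝ) ^ m) ^ (alternations t y).card) := by
        refine sum_le_sum fun y _ => ?_
        rw [walkFourier_period_mul hp, ← pow_mul, mul_comm, pow_mul]
        exact pow_le_pow_left₀ (walkFourier_nonneg _ _) (walkFourier_period_le hodd hp y) m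
    _ = ∑ q ∈ image (fun y : ZMod p => (decide (LeadingOne y), alternations t y))
          {y : ZMod p | y ≠ 0}, ((1 / 3 : ℝ) ^ m) ^ q.2.card :=
        (sum_image (f := fun q => ((1 / 3 : ℝ) ^ m) ^ q.2.card) hinj).symm
    _ ≤ ∑ q ∈ (univ : Finset Bool) ×ˢ (range t).powerset.erase ∅,
          ((1 / 3 : ℝ) ^ m) ^ q.2.card := by
        refine sum_le_sum_of_subset_of_nonneg ?_ fun _ _ _ => by positivity
        intro q hq
        obtain ⟨y, hy, rfl⟩ := mem_image.1 hq
        simp only [mem_product, mem_univ, true_and, mem_erase, mem_powerset]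
        exact ⟨fun h => (mem_filter.1 hy).2 (eq_zero_of_alternations_eq_empty hodd hp h),
          filter_subset _ _⟩
    _ = 2 * (((1 / 3) ^ m + 1) ^ t - 1) := by
        simp only [sum_product]
        rw [sum_const, card_univ, Fintype.card_bool, nsmul_eq_mul,
          sum_erase_eq_sub (by simp)]
        have := sum_pow_mul_eq_add_pow ((1 / 3 : ℝ) ^ m) 1 (range t)
        simp only [one_pow, mul_one, card_range] at this
        rw [this]
        simp

end Mersenne

open Real in
lemma log_mersenne_bounds {p t : ℕ} (ht : 16 ≤ t) (hp : p + 1 = 2 ^ t) :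
    t / 4 ≤ log p ∧ log p ≤ t ∧ log t / 2 ≤ log (log p) ∧ log (log p) ≤ log t := by
  have ht' : (16 : ℝ) ≤ t := by exact_mod_cast ht
  have hp1 : 2 ^ (t - 1) ≤ p := by
    have : 2 ^ t = 2 * 2 ^ (t - 1) := by rw [← pow_succ']; congr 1; omega
    have := Nat.one_le_two_pow (n := t - 1)
    omega
  have hp0 : (0 : ℝ) < p := by exact_mod_cast (pow_pos two_pos _).trans_le hp1
  have h1 : t / 4 ≤ log p := by
    have h : log ((2 : ℝ) ^ (t - 1)) ≤ log p := log_le_log (by positivity) (by exact_mod_cast hp1)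
    rw [log_pow, Nat.cast_sub (by omega), Nat.cast_one] at h
    nlinarith [log_two_gt_d9]
  have h2 : log p ≤ t := by
    have h : log p ≤ log ((2 : ℝ) ^ t) := log_le_log hp0 (by exact_mod_cast (by omega : p ≤ 2 ^ t))
    rw [log_pow] at h
    nlinarith [log_two_lt_d9]
  refine ⟨h1, h2, ?_, log_le_log (by linarith) h2⟩
  rw [← log_sqrt (by linarith)]
  refine log_le_log (sqrt_pos.2 (by linarith)) (le_trans ?_ h1)
  rw [sqrt_le_left (by linarith)]
  nlinarith

lemma exists_mixing_time {p t : ℕ} [NeZero p] (ht : 16 ≤ t) (hodd : Odd p)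
    (hp : p + 1 = 2 ^ t) :
    ∃ T : ℕ, T ≤ 3 * t * Real.log t ∧ ∀ u v : ZMod p,
      (1 - 1 / 4 : ℝ) / p ≤ (blockMatrix p (-1) ^ T) u v ∧
        (blockMatrix p (-1) ^ T) u v ≤ (1 + 1 / 4 : ℝ) / p := by
  have ht' : (16 : ℝ) ≤ t := by exact_mod_cast ht
  have hp0 : (0 : ℝ) < p := by exact_mod_cast NeZero.pos p
  have hlog16 : Real.log 16 ≤ Real.log t := Real.log_le_log (by norm_num) ht'
  have hlog : 1 ≤ Real.log t := by
    rw [show (16 : ℝ) = 2 ^ 4 by norm_num, Real.log_pow] at hlog16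
    push_cast at hlog16
    linarith [Real.log_two_gt_d9]
  set m := ⌈Real.log (16 * t)⌉₊ with hm
  have hlog_mul : Real.log (16 * t) = Real.log 16 + Real.log t :=
    Real.log_mul (by norm_num) (by linarith)
  have hm_le : (m : ℝ) ≤ 3 * Real.log t := by
    have := (Nat.ceil_lt_add_one (a := Real.log (16 * t))
      (Real.log_nonneg (by linarith))).le
    linarith
  have h3m : (1 / 3 : ℝ) ^ m ≤ 1 / (16 * t) := by
    rw [one_div_pow]
    refine one_div_le_one_div_of_le (by linarith) ?_
    calc 16 * (t : ℝ) = Real.exp (Real.log (16 * t)) := (Real.exp_log (by linarith)).symm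
      _ ≤ Real.exp m := Real.exp_le_exp.2 (Nat.le_ceil _)
      _ = Real.exp 1 ^ m := by rw [← Real.exp_nat_mul, mul_one]
      _ ≤ 3 ^ m := by
        gcongr
        linarith [Real.exp_one_lt_d9]
  have hpow : ((1 / 3 : ℝ) ^ m + 1) ^ t ≤ 9 / 8 := by
    calc ((1 / 3 : ℝ) ^ m + 1) ^ t ≤ Real.exp (1 / (16 * t)) ^ t := by
          gcongr
          linarith [Real.add_one_le_exp (1 / (16 * t) : ℝ)]
      _ = Real.exp (1 / 16) := by
          rw [← Real.exp_nat_mul]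
          congr 1
          field_simp
      _ ≤ 1 / (1 - 1 / 16) := Real.exp_bound_div_one_sub_of_interval (by norm_num) (by norm_num)
      _ ≤ 9 / 8 := by norm_num
  refine ⟨t * m, ?_, fun u v => ?_⟩
  · push_cast
    nlinarith
  · have h := (abs_blockMatrix_pow_sub_one_le (t * m) u v).trans (sum_walkFourier_le hodd hp m)
    have := abs_le.1 h
    rw [div_le_iff₀ hp0, le_div_iff₀ hp0]
    constructor <;> linarith

lemma le_of_mixing_time {p t T : ℕ} [NeZero p] (ht : 2 ≤ t) (hlog : 120 ≤ Real.log t)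
    (hp : p + 1 = 2 ^ t) (hT : (blockMatrix p (-1) ^ T) 0 0 ≤ (1 + 1 / 4 : ℝ) / p) :
    1 / 120 * t * Real.log t ≤ T := by
  have hp0 : (0 : ℝ) < p := by exact_mod_cast NeZero.pos p
  have ht0 : (0 : ℝ) < t := by exact_mod_cast (by omega : 0 < t)
  by_contra! hlt
  have hTm : T ≤ t * (T / t + 1) := (Nat.lt_mul_div_succ T (by omega)).le
  have hm : ((T / t : ℕ) : ℝ) ≤ 1 / 120 * Real.log t := by
    refine Nat.cast_div_le.trans ?_
    rw [div_le_iff₀ ht0]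
    linarith
  have h1 := mul_exp_le_sum_walkFourier ht hp hTm
  have h2 := blockMatrix_pow_apply_zero (N := p) T
  rw [le_div_iff₀ hp0] at hT
  have h3 : (1 : ℝ) ≤ t * Real.exp (-60 * (T / t + 1 : ℕ)) := by
    nth_rewrite 1 [← Real.exp_log ht0]
    rw [← Real.exp_add]
    refine Real.one_le_exp ?_
    push_cast
    linarith
  linarith

theorem block_walk_mixing_time_order :
    ∃ c₁ c₂ : ℝ, 0 < c₁ ∧ 0 < c₂ ∧ ∃ t₀ : ℕ, ∀ t : ℕ, t₀ ≤ t →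
      ∀ (p : ℕ) [NeZero p], p = 2 ^ t - 1 → p.Prime →
        c₁ * Real.log p * Real.log (Real.log p)
            ≤ (blockMixTime p ((p - 1 : ℕ) : ZMod p) (1 / 4) : ℝ) ∧
        (blockMixTime p ((p - 1 : ℕ) : ZMod p) (1 / 4) : ℝ)
            ≤ c₂ * Real.log p * Real.log (Real.log p) := by
  refine ⟨1 / 120, 24, by norm_num, by norm_num, ⌈Real.exp 120⌉₊, fun t ht p _ hp hprime => ?_⟩
  have hexp : Real.exp 120 ≤ t := Nat.ceil_le.1 ht
  have ht16 : 16 ≤ t := by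
    have : (16 : ℝ) ≤ t := by linarith [Real.add_one_le_exp (120 : ℝ)]
    exact_mod_cast this
  have ht0 : (0 : ℝ) < t := by exact_mod_cast (by omega : 0 < t)
  have hlogt : 120 ≤ Real.log t := (Real.le_log_iff_exp_le ht0).2 hexp
  have hp1 : p + 1 = 2 ^ t := by have := Nat.one_le_two_pow (n := t); omega
  have hodd : Odd p := by
    rw [hp]
    exact Nat.Even.sub_odd Nat.one_le_two_pow (even_two.pow_of_ne_zero (by omega)) odd_one
  have hx : ((p - 1 : ℕ) : ZMod p) = -1 := by
    rw [Nat.cast_sub hprime.one_le]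
    simp
  obtain ⟨hL, hL', hLL, hLL'⟩ := log_mersenne_bounds ht16 hp1
  obtain ⟨T, hT, hmix⟩ := exists_mixing_time ht16 hodd hp1
  rw [hx]
  constructor
  · have hmem := Nat.sInf_mem (s := {T : ℕ | ∀ u v : ZMod p,
      (1 - 1 / 4 : ℝ) / p ≤ (blockMatrix p (-1) ^ T) u v ∧
        (blockMatrix p (-1) ^ T) u v ≤ (1 + 1 / 4 : ℝ) / p}) ⟨T, hmix⟩
    refine le_trans ?_ (le_of_mixing_time (by omega) hlogt hp1 (hmem 0 0).2)
    gcongr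
    linarith
  · calc (blockMixTime p (-1) (1 / 4) : ℝ) ≤ T :=
          Nat.cast_le.2 (Nat.sInf_le (s := {T : ℕ | ∀ u v : ZMod p,
            (1 - 1 / 4 : ℝ) / p ≤ (blockMatrix p (-1) ^ T) u v ∧
              (blockMatrix p (-1) ^ T) u v ≤ (1 + 1 / 4 : ℝ) / p}) hmix)
      _ ≤ 3 * t * Real.log t := hT
      _ = 24 * (t / 4) * (Real.log t / 2) := by ring
      _ ≤ 24 * Real.log p * Real.log (Real.log p) := by gcongr
end

section
/- Let b = ε_1 + ⋯ + ε_M (a sum over the integers, not reduced modulo anything), where M is geometric with Pr[M = k] = (1/3)(2/3)^k for k ≥ 0 and ε_i are i.i.d. uniform on {+1, −1}. Then for every k ∈ ℤ, Pr[b = k] = (1/√5)·((3−√5)/2)^{|k|}. Equivalently, ∑_{m ≥ |k|, m ≡ k (mod 2)} (1/3)·(1/3)^m·C(m, (m+k)/2) = (1/√5)·((3−√5)/2)^{|k|}. -/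
/-- The number of `±1` walks with `m` steps that end at `k`. -/
def walkCount (m : ℕ) (k : ℤ) : ℕ :=
  if k.natAbs ≤ m ∧ (m : ℤ) % 2 = k % 2 then m.choose (((m : ℤ) + k) / 2).toNat else 0

theorem walkCount_two_mul_sub (m j : ℕ) : walkCount m (2 * j - m) = m.choose j := by
  unfold walkCount
  have h : (((m : ℤ) + (2 * j - m)) / 2).toNat = j := by omega
  rw [h]
  split_ifs with hc
  · rfl
  · rw [Nat.choose_eq_zero_of_lt (by omega)]

theorem walkCount_zero (k : ℤ) : walkCount 0 k = if k = 0 then 1 else 0 := by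
  unfold walkCount
  by_cases hk : k = 0
  · simp [hk]
  · rw [if_neg (by omega), if_neg hk]

theorem walkCount_succ (m : ℕ) (k : ℤ) :
    walkCount (m + 1) k = walkCount m (k - 1) + walkCount m (k + 1) := by
  by_cases hp : ((m + 1 : ℕ) : ℤ) % 2 = k % 2 ∧ -(m + 1 : ℤ) ≤ k
  · obtain ⟨j, hj⟩ : ∃ j : ℕ, k = 2 * j - (m + 1 : ℕ) :=
      ⟨(((m : ℤ) + 1 + k) / 2).toNat, by omega⟩
    subst hj
    rw [walkCount_two_mul_sub]
    have hr : (2 * j - (m + 1 : ℕ) + 1 : ℤ) = 2 * j - m := by push_cast; ring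
    rw [hr, walkCount_two_mul_sub]
    cases j with
    | zero =>
      have hz : walkCount m (2 * (0 : ℕ) - (m + 1 : ℕ) - 1) = 0 := if_neg (by omega)
      rw [hz]
      simp
    | succ i =>
      have hl : (2 * (i + 1 : ℕ) - (m + 1 : ℕ) - 1 : ℤ) = 2 * i - m := by push_cast; ring
      rw [hl, walkCount_two_mul_sub, Nat.choose_succ_succ]
  · unfold walkCount
    rw [if_neg (by omega), if_neg (by omega), if_neg (by omega)]

/-- A two-sided geometric sequence `r ^ |k|` satisfies a three-term recurrence with a source at
the origin. -/
theorem pow_natAbs_recurrence (r : ℝ) (hr : r ^ 2 = 3 * r - 1) (k : ℤ) :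
    3 * r ^ k.natAbs =
      r ^ (k - 1).natAbs + r ^ (k + 1).natAbs + if k = 0 then 3 - 2 * r else 0 := by
  rcases lt_trichotomy k 0 with hk | rfl | hk
  · obtain ⟨n, hn⟩ : ∃ n : ℕ, k.natAbs = n + 1 := ⟨k.natAbs - 1, by omega⟩
    rw [if_neg hk.ne, hn, show (k - 1).natAbs = n + 2 by omega,
      show (k + 1).natAbs = n by omega]
    linear_combination -r ^ n * hr
  · norm_num
    ring
  · obtain ⟨n, hn⟩ : ∃ n : ℕ, k.natAbs = n + 1 := ⟨k.natAbs - 1, by omega⟩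
    rw [if_neg hk.ne', hn, show (k - 1).natAbs = n by omega,
      show (k + 1).natAbs = n + 2 by omega]
    linear_combination -r ^ n * hr

theorem sum_range_walkCount_succ (n : ℕ) (k : ℤ) :
    ∑ m ∈ Finset.range (n + 1), (1 / 3 : ℝ) * (1 / 3) ^ m * walkCount m k =
      ((∑ m ∈ Finset.range n, (1 / 3 : ℝ) * (1 / 3) ^ m * walkCount m (k - 1)) +
        (∑ m ∈ Finset.range n, (1 / 3 : ℝ) * (1 / 3) ^ m * walkCount m (k + 1)) +
        if k = 0 then 1 else 0) / 3 := by
  rw [Finset.sum_range_succ', ← Finset.sum_add_distrib, add_div, Finset.sum_div, walkCount_zero]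
  congr 1
  · refine Finset.sum_congr rfl fun m _ => ?_
    rw [walkCount_succ]
    push_cast
    ring
  · split_ifs <;> norm_num

/-- The partial sums converge geometrically, uniformly in the endpoint, to any bounded solution
of the recurrence. -/
theorem abs_sum_range_walkCount_sub_le (q : ℤ → ℝ) (hq : ∀ k, |q k| ≤ 1)
    (hrec : ∀ k, q k = (q (k - 1) + q (k + 1) + if k = 0 then 1 else 0) / 3) (n : ℕ) (k : ℤ) :
    |∑ m ∈ Finset.range n, (1 / 3 : ℝ) * (1 / 3) ^ m * walkCount m k - q k| ≤ (2 / 3) ^ n := by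
  induction n generalizing k with
  | zero => simpa using hq k
  | succ n ih =>
    have hl := abs_le.mp (ih (k - 1))
    have hr := abs_le.mp (ih (k + 1))
    rw [sum_range_walkCount_succ, hrec k, pow_succ, abs_le]
    constructor <;> linarith [hl.1, hl.2, hr.1, hr.2]

theorem hasSum_walkCount (q : ℤ → ℝ) (hq : ∀ k, |q k| ≤ 1)
    (hrec : ∀ k, q k = (q (k - 1) + q (k + 1) + if k = 0 then 1 else 0) / 3) (k : ℤ) :
    HasSum (fun m : ℕ => (1 / 3 : ℝ) * (1 / 3) ^ m * walkCount m k) (q k) := by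
  rw [hasSum_iff_tendsto_nat_of_nonneg (fun m => by positivity), tendsto_iff_dist_tendsto_zero]
  exact squeeze_zero (fun _ => dist_nonneg)
    (fun n => abs_sum_range_walkCount_sub_le q hq hrec n k)
    (tendsto_pow_atTop_nhds_zero_of_lt_one (by norm_num) (by norm_num))


/-- The distribution of `b = ε₁ + ⋯ + ε_M` (over the integers), where `M` is geometric with
`Pr[M = m] = (1/3)(2/3)^m` and the `εᵢ` are i.i.d. uniform on `{+1, −1}`:
for every `k ∈ ℤ`,
`Pr[b = k] = ∑_{m ≥ |k|, m ≡ k (mod 2)} (1/3)(1/3)^m C(m, (m+k)/2)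
           = (1/√5)·((3−√5)/2)^{|k|}`. -/
theorem block_increment_distribution (k : ℤ) :
    ∑' m : ℕ, (if k.natAbs ≤ m ∧ (m : ℤ) % 2 = k % 2
        then (1 / 3 : ℝ) * (1 / 3) ^ m * (m.choose (((m : ℤ) + k) / 2).toNat : ℝ)
        else 0)
      = (1 / Real.sqrt 5) * ((3 - Real.sqrt 5) / 2) ^ k.natAbs := by
  have hs : Real.sqrt 5 ^ 2 = 5 := Real.sq_sqrt (by norm_num)
  have hs1 : 1 ≤ Real.sqrt 5 := Real.one_le_sqrt.mpr (by norm_num)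
  have hs3 : Real.sqrt 5 ≤ 3 := Real.sqrt_le_iff.mpr (by norm_num)
  have hsum := hasSum_walkCount
    (fun k => (1 / Real.sqrt 5) * ((3 - Real.sqrt 5) / 2) ^ k.natAbs) ?_ ?_ k
  · rw [← hsum.tsum_eq]
    refine tsum_congr fun m => ?_
    unfold walkCount
    split_ifs <;> simp
  · intro k
    have hr0 : 0 ≤ (3 - Real.sqrt 5) / 2 := by linarith
    rw [abs_of_nonneg (by positivity)]
    exact mul_le_one₀ ((div_le_one (by linarith)).mpr hs1) (by positivity)
      (pow_le_one₀ hr0 (by linarith))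
  · intro k
    have h := pow_natAbs_recurrence ((3 - Real.sqrt 5) / 2) (by linear_combination hs / 4) k
    have hne : Real.sqrt 5 ≠ 0 := by linarith
    split_ifs at h ⊢ <;> field_simp <;> linarith
end

section
/- Let p = 2^t − 1 with t ≥ 6, θ = (3−√5)/2, G(y) = (1/√5)(1−θ²)/(1+θ²−2θcos(2πy)), and Π_1 = ∏_{α=0}^{t−1} G(2^α/p). Then Π_1 ≥ 5^{−5}·exp( −5/( 2^5·(1 − 5/2^6 − 5/2^t) ) ) and Π_1 ≤ G(2^{t−1}/p); consequently Π_1 is bounded away from 0 and 1 as t → ∞ (in particular lim_{t→∞} G(2^{t−1}/p) = 1/5). -/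
open Filter

/-- `G(y) = (1/√5)·(1 − θ²)/(1 + θ² − 2θ·cos(2πy))` with `θ = (3−√5)/2`. -/
noncomputable def Gfun (y : ℝ) : ℝ :=
  (1 / Real.sqrt 5) * (1 - ((3 - Real.sqrt 5) / 2) ^ 2) /
    (1 + ((3 - Real.sqrt 5) / 2) ^ 2 -
      2 * ((3 - Real.sqrt 5) / 2) * Real.cos (2 * Real.pi * y))

/-- `Π₁ = ∏_{α=0}^{t−1} G(2^α/p)` where `p = 2^t − 1`. -/
noncomputable def Pi1 (t : ℕ) : ℝ :=
  ∏ α ∈ Finset.range t, Gfun ((2 : ℝ) ^ α / ((2 : ℝ) ^ t - 1))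

theorem Gfun_eq (y : ℝ) : Gfun y = 1 / (3 - 2 * Real.cos (2 * Real.pi * y)) := by
  have h5 : Real.sqrt 5 ^ 2 = 5 := Real.sq_sqrt (by norm_num)
  have hs : 0 < Real.sqrt 5 := Real.sqrt_pos.2 (by norm_num)
  have hlt : Real.sqrt 5 < 3 := by nlinarith
  have hc := Real.cos_le_one (2 * Real.pi * y)
  unfold Gfun
  set s := Real.sqrt 5
  set c := Real.cos (2 * Real.pi * y)
  have hnum : 1 / s * (1 - ((3 - s) / 2) ^ 2) = (3 - s) / 2 := by
    field_simp
    linear_combination h5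
  have hden : 1 + ((3 - s) / 2) ^ 2 - 2 * ((3 - s) / 2) * c =
      (3 - s) / 2 * (3 - 2 * c) := by
    linear_combination h5 / 4
  have hθ : 3 - s ≠ 0 := by linarith
  have hd : 3 - 2 * c ≠ 0 := by linarith
  rw [hnum, hden]
  field_simp

theorem one_fifth_le_Gfun (y : ℝ) : 1 / 5 ≤ Gfun y := by
  rw [Gfun_eq]
  have h1 := Real.cos_le_one (2 * Real.pi * y)
  have h2 := Real.neg_one_le_cos (2 * Real.pi * y)
  exact one_div_le_one_div_of_le (by linarith) (by linarith)

theorem Gfun_pos (y : ℝ) : 0 < Gfun y :=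
  lt_of_lt_of_le (by norm_num) (one_fifth_le_Gfun y)

theorem Gfun_le_one (y : ℝ) : Gfun y ≤ 1 := by
  rw [Gfun_eq]
  have h1 := Real.cos_le_one (2 * Real.pi * y)
  rw [div_le_one (by linarith)]
  linarith

theorem exp_neg_le_Gfun (y : ℝ) : Real.exp (-(40 * y ^ 2)) ≤ Gfun y := by
  rw [Gfun_eq, Real.exp_neg, ← one_div]
  have h1 := Real.cos_le_one (2 * Real.pi * y)
  have h2 := Real.one_sub_sq_div_two_le_cos (x := 2 * Real.pi * y)
  have h3 := Real.add_one_le_exp (40 * y ^ 2)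
  have hpi : Real.pi ^ 2 ≤ 10 := by
    nlinarith [Real.pi_lt_d2, Real.pi_pos]
  have h4 : Real.pi ^ 2 * y ^ 2 ≤ 10 * y ^ 2 :=
    mul_le_mul_of_nonneg_right hpi (sq_nonneg y)
  exact one_div_le_one_div_of_le (by linarith) (by nlinarith)

theorem continuous_Gfun : Continuous Gfun := by
  rw [funext Gfun_eq]
  refine continuous_const.div (by fun_prop) fun y => ?_
  linarith [Real.cos_le_one (2 * Real.pi * y)]

theorem Gfun_half : Gfun (1 / 2) = 1 / 5 := by
  rw [Gfun_eq, show 2 * Real.pi * (1 / 2) = Real.pi by ring, Real.cos_pi]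
  norm_num

theorem Pi1_le_Gfun {t : ℕ} (ht : 1 ≤ t) :
    Pi1 t ≤ Gfun ((2 : ℝ) ^ (t - 1) / ((2 : ℝ) ^ t - 1)) := by
  obtain ⟨n, rfl⟩ := Nat.exists_eq_add_of_le' ht
  rw [Pi1, Finset.prod_range_succ, Nat.add_sub_cancel]
  exact mul_le_of_le_one_left (Gfun_pos _).le
    (Finset.prod_le_one (fun _ _ => (Gfun_pos _).le) fun _ _ => Gfun_le_one _)

theorem sum_sq_le (n : ℕ) :
    ∑ α ∈ Finset.range n, 40 * ((2 : ℝ) ^ α / ((2 : ℝ) ^ (n + 5) - 1)) ^ 2 ≤ 5 / 32 := by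
  have hgeom : ∑ α ∈ Finset.range n, ((2 : ℝ) ^ α) ^ 2 = (((2 : ℝ) ^ n) ^ 2 - 1) / 3 := by
    simp_rw [← pow_mul, mul_comm _ 2, pow_mul]
    rw [geom_sum_eq (by norm_num)]
    norm_num
  have hq : (1 : ℝ) ≤ 2 ^ n := one_le_pow₀ (by norm_num)
  simp_rw [div_pow]
  rw [← Finset.mul_sum, ← Finset.sum_div, hgeom, pow_add]
  set q : ℝ := 2 ^ n
  have hpos : 0 < (q * 2 ^ 5 - 1) ^ 2 := pow_pos (by linarith) 2
  rw [← mul_div_assoc, div_le_iff₀ hpos]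
  nlinarith

theorem le_Pi1 (n : ℕ) : (5 : ℝ) ^ (-5 : ℤ) * Real.exp (-(5 / 32)) ≤ Pi1 (n + 5) := by
  have htail : (5 : ℝ) ^ (-5 : ℤ) ≤
      ∏ i ∈ Finset.range 5, Gfun ((2 : ℝ) ^ (n + i) / ((2 : ℝ) ^ (n + 5) - 1)) :=
    calc (5 : ℝ) ^ (-5 : ℤ) = ∏ _i ∈ Finset.range 5, (1 / 5 : ℝ) := by
          rw [Finset.prod_const, Finset.card_range]; norm_num
      _ ≤ _ := Finset.prod_le_prod (fun _ _ => by norm_num) fun _ _ => one_fifth_le_Gfun _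
  have hhead : Real.exp (-(5 / 32)) ≤
      ∏ α ∈ Finset.range n, Gfun ((2 : ℝ) ^ α / ((2 : ℝ) ^ (n + 5) - 1)) := by
    refine le_trans ?_ (Finset.prod_le_prod (fun _ _ => (Real.exp_pos _).le)
      fun _ _ => exp_neg_le_Gfun _)
    rw [← Real.exp_sum, Real.exp_le_exp, Finset.sum_neg_distrib, neg_le_neg_iff]
    exact sum_sq_le n
  rw [Pi1, Finset.prod_range_add, mul_comm]
  exact mul_le_mul hhead htail (by positivity)
    (Finset.prod_nonneg fun _ _ => (Gfun_pos _).le)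

theorem tendsto_two_pow_div :
    Tendsto (fun t : ℕ => (2 : ℝ) ^ (t - 1) / ((2 : ℝ) ^ t - 1)) atTop (nhds (1 / 2)) := by
  have hlim : Tendsto (fun t : ℕ => (1 / 2 : ℝ) / (1 - (1 / 2) ^ t)) atTop
      (nhds ((1 / 2) / (1 - 0))) :=
    tendsto_const_nhds.div (tendsto_const_nhds.sub
      (tendsto_pow_atTop_nhds_zero_of_lt_one (by norm_num) (by norm_num))) (by norm_num)
  rw [sub_zero, div_one] at hlim
  refine hlim.congr' ?_
  filter_upwards [eventually_ge_atTop 1] with t ht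
  obtain ⟨n, rfl⟩ := Nat.exists_eq_add_of_le' ht
  have hq : (1 : ℝ) ≤ 2 ^ n := one_le_pow₀ (by norm_num)
  rw [Nat.add_sub_cancel, one_div_pow, pow_succ]
  have h1 : (2 : ℝ) ^ n * 2 - 1 ≠ 0 := by linarith
  field_simp

theorem Pi1_bounded_away :
    (∀ t : ℕ, 6 ≤ t →
      (5 : ℝ) ^ (-5 : ℤ) *
          Real.exp (-5 / (2 ^ 5 * (1 - 5 / 2 ^ 6 - 5 / 2 ^ t))) ≤ Pi1 t ∧
      Pi1 t ≤ Gfun ((2 : ℝ) ^ (t - 1) / ((2 : ℝ) ^ t - 1))) ∧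
    Tendsto (fun t : ℕ => Gfun ((2 : ℝ) ^ (t - 1) / ((2 : ℝ) ^ t - 1))) atTop
      (nhds (1 / 5)) ∧
    (∃ δ : ℝ, 0 < δ ∧ ∀ᶠ t : ℕ in atTop, δ ≤ Pi1 t ∧ Pi1 t ≤ 1 - δ) := by
  have hlower : ∀ t : ℕ, 6 ≤ t → (5 : ℝ) ^ (-5 : ℤ) * Real.exp (-(5 / 32)) ≤ Pi1 t := by
    intro t ht
    obtain ⟨n, rfl⟩ := Nat.exists_eq_add_of_le' (le_trans (by norm_num : 5 ≤ 6) ht)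
    exact le_Pi1 n
  have hlim : Tendsto (fun t : ℕ => Gfun ((2 : ℝ) ^ (t - 1) / ((2 : ℝ) ^ t - 1))) atTop
      (nhds (1 / 5)) := by
    rw [← Gfun_half]
    exact (continuous_Gfun.tendsto _).comp tendsto_two_pow_div
  refine ⟨fun t ht => ⟨le_trans ?_ (hlower t ht), Pi1_le_Gfun (by omega)⟩, hlim,
    (5 : ℝ) ^ (-5 : ℤ) * Real.exp (-(5 / 32)), by positivity, ?_⟩
  · have hpow : (2 : ℝ) ^ 6 ≤ 2 ^ t := pow_le_pow_right₀ (by norm_num) ht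
    have hsmall : (5 : ℝ) / 2 ^ t ≤ 5 / 2 ^ 6 :=
      div_le_div_of_nonneg_left (by norm_num) (by norm_num) hpow
    have hnonneg : (0 : ℝ) ≤ 5 / 2 ^ t := by positivity
    refine mul_le_mul_of_nonneg_left (Real.exp_le_exp.2 ?_) (by positivity)
    rw [neg_div, neg_le_neg_iff]
    exact div_le_div_of_nonneg_left (by norm_num) (by linarith) (by linarith)
  · have hδ : (5 : ℝ) ^ (-5 : ℤ) * Real.exp (-(5 / 32)) ≤ 1 / 2 :=
      calc (5 : ℝ) ^ (-5 : ℤ) * Real.exp (-(5 / 32)) ≤ (5 : ℝ) ^ (-5 : ℤ) * 1 :=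
            mul_le_mul_of_nonneg_left (Real.exp_le_one_iff.2 (by norm_num)) (by positivity)
        _ ≤ 1 / 2 := by norm_num
    filter_upwards [eventually_ge_atTop 6,
      hlim.eventually_le_const (by norm_num : (1 / 5 : ℝ) < 1 / 2)] with t ht hG
    exact ⟨hlower t ht, by linarith [Pi1_le_Gfun (t := t) (by omega)]⟩
end
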